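/- Let n ≥ 1, m ≥ 1, B₀ ∈ ℂ^{n×n}, λ₁,…,λ_m ∈ ℝ and α₁,…,α_m ∈ ℝ with α_j > 0 for all j. Let B_g ∈ ℂ^{(m+2)n×(m+2)n} be the block matrix with n×n blocks whose first block row is (0, I_n, 0, …, 0), whose second block row is (B₀, 0, λ₁I_n, …, λ_mI_n), and whose (2+j)-th block row (j = 1,…,m) has −λ_jI_n in the second block column, −α_jI_n in the (2+j)-th block column, and zeros elsewhere. Then for every ν ∈ ℂ with ν ≠ −α_j for all j, ν is an eigenvalue of B_g if and only if ν(ν + Σ_{j=1}^m λ_j²/(ν+α_j)) is an eigenvalue of B₀. -/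

import Mathlib

open Matrix

/-- A scalar is in the spectrum of a square matrix over a field iff it has an eigenvector. -/
theorem Matrix.mem_spectrum_iff_exists_mulVec {K ι : Type*} [Field K] [Fintype ι] [DecidableEq ι]
    (A : Matrix ι ι K) (μ : K) :
    μ ∈ spectrum K A ↔ ∃ v : ι → K, v ≠ 0 ∧ A *ᵥ v = μ • v := by
  rw [← Matrix.spectrum_toLin', ← Module.End.hasEigenvalue_iff_mem_spectrum]
  constructor
  · intro h
    obtain ⟨v, hv⟩ := h.exists_hasEigenvector
    exact ⟨v, hv.2, by simpa using hv.apply_eq_smul⟩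
  · rintro ⟨v, hv, h⟩
    exact Module.End.hasEigenvalue_of_hasEigenvector
      (Module.End.hasEigenvector_iff.2 ⟨Module.End.mem_eigenspace_iff.2 (by simpa using h), hv⟩)

theorem stmt_3 (n m : ℕ) (hn : 1 ≤ n) (hm : 1 ≤ m)
    (B₀ : Matrix (Fin n) (Fin n) ℂ) (lam alph : Fin m → ℝ) (halph : ∀ j, 0 < alph j)
    (Bg : Matrix (Fin n ⊕ (Fin n ⊕ Fin m × Fin n)) (Fin n ⊕ (Fin n ⊕ Fin m × Fin n)) ℂ)
    (hBg :
      (∀ a b : Fin n, Bg (Sum.inl a) (Sum.inl b) = 0) ∧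
      (∀ a b : Fin n, Bg (Sum.inl a) (Sum.inr (Sum.inl b)) = if a = b then 1 else 0) ∧
      (∀ (a : Fin n) (j : Fin m) (b : Fin n), Bg (Sum.inl a) (Sum.inr (Sum.inr (j, b))) = 0) ∧
      (∀ a b : Fin n, Bg (Sum.inr (Sum.inl a)) (Sum.inl b) = B₀ a b) ∧
      (∀ a b : Fin n, Bg (Sum.inr (Sum.inl a)) (Sum.inr (Sum.inl b)) = 0) ∧
      (∀ (a : Fin n) (j : Fin m) (b : Fin n),
        Bg (Sum.inr (Sum.inl a)) (Sum.inr (Sum.inr (j, b))) =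
          (lam j : ℂ) * (if a = b then 1 else 0)) ∧
      (∀ (j : Fin m) (a : Fin n) (b : Fin n), Bg (Sum.inr (Sum.inr (j, a))) (Sum.inl b) = 0) ∧
      (∀ (j : Fin m) (a : Fin n) (b : Fin n),
        Bg (Sum.inr (Sum.inr (j, a))) (Sum.inr (Sum.inl b)) =
          -(lam j : ℂ) * (if a = b then 1 else 0)) ∧
      (∀ (j : Fin m) (a : Fin n) (k : Fin m) (b : Fin n),
        Bg (Sum.inr (Sum.inr (j, a))) (Sum.inr (Sum.inr (k, b))) =
          if j = k ∧ a = b then -(alph j : ℂ) else 0))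
    (ν : ℂ) (hν : ∀ j, ν ≠ -(alph j : ℂ)) :
    ν ∈ spectrum ℂ Bg ↔
      ν * (ν + ∑ j, (lam j : ℂ) ^ 2 / (ν + (alph j : ℂ))) ∈ spectrum ℂ B₀ := by
  obtain ⟨h11, h12, h13, h21, h22, h23, h31, h32, h33⟩ := hBg
  have hne : ∀ j, ν + (alph j : ℂ) ≠ 0 := fun j h => hν j (eq_neg_of_add_eq_zero_left h)
  have eigen_iff : ∀ v, Bg *ᵥ v = ν • v ↔
      (∀ a, v (.inr (.inl a)) = ν * v (.inl a)) ∧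
      (∀ a, (B₀ *ᵥ fun b => v (.inl b)) a + ∑ j, (lam j : ℂ) * v (.inr (.inr (j, a))) =
        ν * v (.inr (.inl a))) ∧
      (∀ j a, -((lam j : ℂ) * v (.inr (.inl a))) + -((alph j : ℂ) * v (.inr (.inr (j, a)))) =
        ν * v (.inr (.inr (j, a)))) := by
    intro v
    simp [funext_iff, mulVec, dotProduct, Fintype.sum_sum_type, Fintype.sum_prod_type, h11, h12,
      h13, h21, h22, h23, h31, h32, h33, ite_and]
  rw [mem_spectrum_iff_exists_mulVec, mem_spectrum_iff_exists_mulVec]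
  constructor
  · rintro ⟨v, hv0, hv⟩
    obtain ⟨hy, hx, hz⟩ := (eigen_iff v).1 hv
    have hz' : ∀ j a, v (.inr (.inr (j, a))) =
        -((lam j : ℂ) * (ν * v (.inl a))) / (ν + (alph j : ℂ)) := by
      intro j a
      rw [eq_div_iff (hne j), ← hy a]
      linear_combination -hz j a
    refine ⟨fun b => v (.inl b), fun h => hv0 ?_, ?_⟩
    · have h0 : ∀ a, v (.inl a) = 0 := congrFun h
      funext i
      rcases i with a | a | ⟨j, a⟩
      · exact h0 a
      · simp [hy, h0]
      · simp [hz', h0]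
    · funext a
      have hsum : ∑ j, (lam j : ℂ) * v (.inr (.inr (j, a))) =
          -((∑ j, (lam j : ℂ) ^ 2 / (ν + (alph j : ℂ))) * (ν * v (.inl a))) := by
        rw [Finset.sum_mul, ← Finset.sum_neg_distrib]
        refine Finset.sum_congr rfl fun j _ => ?_
        rw [hz']
        ring
      have := hx a
      rw [hsum, hy a] at this
      simp only [Pi.smul_apply, smul_eq_mul]
      linear_combination this
  · rintro ⟨x, hx0, hx⟩
    refine ⟨Sum.elim x (Sum.elim (fun a => ν * x a) fun p =>
      -((lam p.1 : ℂ) * (ν * x p.2)) / (ν + (alph p.1 : ℂ))), fun h => hx0 ?_, ?_⟩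
    · funext a
      exact congrFun h (.inl a)
    · rw [eigen_iff]
      refine ⟨fun a => rfl, fun a => ?_, fun j a => ?_⟩
      · have hsum : ∑ j, (lam j : ℂ) * (-((lam j : ℂ) * (ν * x a)) / (ν + (alph j : ℂ))) =
            -((∑ j, (lam j : ℂ) ^ 2 / (ν + (alph j : ℂ))) * (ν * x a)) := by
          rw [Finset.sum_mul, ← Finset.sum_neg_distrib]
          exact Finset.sum_congr rfl fun j _ => by ring
        have := congrFun hx a
        simp only [Pi.smul_apply, smul_eq_mul] at this
        simp only [Sum.elim_inl, Sum.elim_inr]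
        rw [hsum]
        linear_combination this
      · have := hne j
        simp only [Sum.elim_inl, Sum.elim_inr]
        field_simp
        ring
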